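/- arXiv:2509.09391 — 9 statements merged into one kernel-verified Lean document; each statement's English description precedes it below -/
import Mathlib

section
/- Assume the setup below, fix points x^{n-2}, x^{n-1}, x^n ∈ X and β ∈ [0,1), set y^n = x^n + β(x^n − x^{n-1}), and suppose x^{n+1} ∈ X satisfies the implicit-explicit optimality condition with subgradient w. Then E^n(x^{n+1}) ≤ E^n(x^n) − ((α+1)/δt − L/2) ‖x^{n+1} − x^n‖² − (1 − β/2) ‖x^{n+1} − x^n‖_M² + (β/2) ‖x^n − x^{n-1}‖_M². -/
open scoped RealInnerProductSpace

/-- The descent lemma: a function with `L`-Lipschitz gradient is bounded above by its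
quadratic model. -/
theorem le_quadratic_model_of_lipschitz_gradient {X : Type*} [NormedAddCommGroup X]
    [InnerProductSpace ℝ X] [CompleteSpace X] {F : X → ℝ} {f : X → X} {L : ℝ}
    (hF : ∀ x : X, HasGradientAt F (f x) x)
    (hf : ∀ x y : X, ‖f x - f y‖ ≤ L * ‖x - y‖) (x d : X) :
    F (x + d) ≤ F x + ⟪f x, d⟫ + L / 2 * ‖d‖ ^ 2 := by
  have hderiv : ∀ t : ℝ, HasDerivAt
      (fun t : ℝ => F (x + t • d) - t * ⟪f x, d⟫ - L / 2 * ‖d‖ ^ 2 * t ^ 2)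
      (⟪f (x + t • d), d⟫ - ⟪f x, d⟫ - L * ‖d‖ ^ 2 * t) t := by
    intro t
    have hline : HasDerivAt (fun t : ℝ => x + t • d) d t := by
      simpa using ((hasDerivAt_id t).smul_const d).const_add x
    have hcomp : HasDerivAt (fun t : ℝ => F (x + t • d)) ⟪f (x + t • d), d⟫ t := by
      simpa [Function.comp_def] using (hF (x + t • d)).hasFDerivAt.comp_hasDerivAt t hline
    refine ((hcomp.sub ((hasDerivAt_id t).mul_const ⟪f x, d⟫)).sub
      ((hasDerivAt_pow 2 t).const_mul (L / 2 * ‖d‖ ^ 2))).congr_deriv ?_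
    norm_num
    ring
  have hanti : AntitoneOn
      (fun t : ℝ => F (x + t • d) - t * ⟪f x, d⟫ - L / 2 * ‖d‖ ^ 2 * t ^ 2) (Set.Ici 0) := by
    refine antitoneOn_of_deriv_nonpos (convex_Ici 0)
      (fun t _ => (hderiv t).continuousAt.continuousWithinAt)
      (fun t _ => (hderiv t).differentiableAt.differentiableWithinAt) fun t ht => ?_
    rw [interior_Ici, Set.mem_Ioi] at ht
    rw [(hderiv t).deriv, ← inner_sub_left]
    have hlip : ‖f (x + t • d) - f x‖ ≤ L * (t * ‖d‖) := by
      simpa [norm_smul, abs_of_pos ht] using hf (x + t • d) x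
    have hcs := real_inner_le_norm (f (x + t • d) - f x) d
    have hmul := mul_le_mul_of_nonneg_right hlip (norm_nonneg d)
    linarith
  have h := hanti (Set.mem_Ici.2 le_rfl) (Set.mem_Ici.2 zero_le_one) zero_le_one
  simp only [one_smul, zero_smul, add_zero] at h
  linarith

/-- Young's inequality for the semi-inner product of a positive semidefinite map. -/
theorem two_mul_inner_map_le_of_psd {X : Type*} [NormedAddCommGroup X]
    [InnerProductSpace ℝ X] {M : X →ₗ[ℝ] X} (hM_sym : ∀ u v : X, ⟪M u, v⟫ = ⟪u, M v⟫)
    (hM_psd : ∀ v : X, 0 ≤ ⟪M v, v⟫) (u v : X) :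
    2 * ⟪M u, v⟫ ≤ ⟪M u, u⟫ + ⟪M v, v⟫ := by
  have h := hM_psd (u - v)
  rw [map_sub, inner_sub_left, inner_sub_right, inner_sub_right, hM_sym v u,
    real_inner_comm (M u) v] at h
  linarith

/-- sufficient-descent inequality for the energy `E^n` along the
implicit-explicit step with extrapolation. -/
theorem stmt2 {X : Type*} [NormedAddCommGroup X] [InnerProductSpace ℝ X]
    [FiniteDimensional ℝ X]
    (δt α L : ℝ) (hδt : 0 < δt) (hα : 0 < α) (hL : 0 ≤ L)
    (H F : X → ℝ) (hH : ConvexOn ℝ Set.univ H)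
    (f : X → X) (hF : ∀ x : X, HasGradientAt F (f x) x)
    (hf : ∀ x y : X, ‖f x - f y‖ ≤ L * ‖x - y‖)
    (M : X →ₗ[ℝ] X)
    (hM_sym : ∀ u v : X, ⟪M u, v⟫ = ⟪u, M v⟫)
    (hM_psd : ∀ v : X, 0 ≤ ⟪M v, v⟫)
    (xn2 xn1 xn : X) (β : ℝ) (hβ : β ∈ Set.Ico (0 : ℝ) 1)
    (yn : X) (hyn : yn = xn + β • (xn - xn1))
    (Hn Fn En : X → ℝ)
    (hHn : ∀ x, Hn x = H x + (1 / δt) * ‖x - xn‖ ^ 2)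
    (hFn : ∀ x, Fn x = (α / δt) * ‖x - xn‖ ^ 2 + (14 / (11 * δt)) * ⟪x - xn, xn - xn1⟫
      - (4 / (11 * δt)) * ⟪x - xn1, xn1 - xn2⟫ - F x
      - 2 * ⟪f xn - f xn1, x - xn1⟫ + ⟪f xn1 - f xn2, x - xn2⟫)
    (hEn : ∀ x, En x = Hn x - Fn x)
    (xs w : X)
    (hw : ∀ z : X, H z ≥ H xs + ⟪w, z - xs⟫)
    (hopt : (12 / (11 * δt)) • ((11 / 6 : ℝ) • xs - (3 : ℝ) • xn + (3 / 2 : ℝ) • xn1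
        - (1 / 3 : ℝ) • xn2) + M (xs - yn) + w
        + (3 : ℝ) • f xn - (3 : ℝ) • f xn1 + f xn2 = 0) :
    En xs ≤ En xn - ((α + 1) / δt - L / 2) * ‖xs - xn‖ ^ 2
      - (1 - β / 2) * ⟪M (xs - xn), xs - xn⟫
      + (β / 2) * ⟪M (xn - xn1), xn - xn1⟫ := by
  obtain ⟨d, rfl⟩ : ∃ d, xs = xn + d := ⟨xs - xn, by abel⟩
  obtain ⟨a, ha⟩ : ∃ a, a = xn - xn1 := ⟨_, rfl⟩
  obtain ⟨b, hb⟩ : ∃ b, b = xn1 - xn2 := ⟨_, rfl⟩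
  have hdescent := le_quadratic_model_of_lipschitz_gradient hF hf xn d
  have hyoung := mul_le_mul_of_nonneg_left (two_mul_inner_map_le_of_psd hM_sym hM_psd a d) hβ.1
  have hsub := hw xn
  have hneg : xn - (xn + d) = -d := by abel
  rw [hneg, inner_neg_right] at hsub
  have hbdf : (11 / 6 : ℝ) • (xn + d) - (3 : ℝ) • xn + (3 / 2 : ℝ) • xn1 - (1 / 3 : ℝ) • xn2
      = (11 / 6 : ℝ) • d - (7 / 6 : ℝ) • a + (1 / 3 : ℝ) • b := by
    rw [ha, hb]; module
  have hext : xn + d - yn = d - β • a := by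
    rw [hyn, ha]; abel
  have hopt' := congrArg (fun v => ⟪v, d⟫) hopt
  simp only [hbdf, hext, map_sub, map_smul, inner_add_left, inner_sub_left, real_inner_smul_left,
    inner_zero_left, real_inner_self_eq_norm_sq] at hopt'
  have h1 : xn + d - xn1 = d + (xn - xn1) := by abel
  have h2 : xn + d - xn2 = d + (xn - xn2) := by abel
  rw [hEn, hEn, hHn, hHn, hFn, hFn, h1, h2, add_sub_cancel_left, sub_self, ← ha, ← hb]
  simp only [inner_add_left, inner_add_right, inner_sub_left, inner_zero_left, norm_zero]
  rw [real_inner_comm a d, real_inner_comm b d]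
  have hc : ∀ c : ℝ, c / (11 * δt) = c / 11 * (1 / δt) := fun c => by field_simp
  rw [hc] at hopt'
  rw [hc, hc, div_eq_mul_one_div α, div_eq_mul_one_div (α + 1)]
  linarith
end

section
/- Assume the setup below and let x^{n-2}, x^{n-1}, x^n, x^{n+1} ∈ X be arbitrary points. Then E^n(x^n) − E^n(x^{n+1}) ≤ E(x^n) − E(x^{n+1}) + ((11α − 2)/(11 δt) + (3/2) L) ‖x^{n+1} − x^n‖² + (7/(11 δt) + L) ‖x^n − x^{n-1}‖² + (2/(11 δt) + L/2) ‖x^{n-1} − x^{n-2}‖². -/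
open scoped RealInnerProductSpace

/-- Young's inequality for an inner product whose first factor is bounded by `L * ‖a‖`. -/
lemma abs_inner_le_of_norm_le_mul {X : Type*} [NormedAddCommGroup X] [InnerProductSpace ℝ X]
    {L : ℝ} (hL : 0 ≤ L) {g a : X} (hg : ‖g‖ ≤ L * ‖a‖) (d : X) :
    |⟪g, d⟫| ≤ L / 2 * (‖a‖ ^ 2 + ‖d‖ ^ 2) := by
  have h₁ := abs_real_inner_le_norm g d
  have h₂ := mul_le_mul_of_nonneg_right hg (norm_nonneg d)
  have h₃ := mul_nonneg hL (sq_nonneg (‖a‖ - ‖d‖))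
  linarith

/-- upper bound on `E^n(x^n) − E^n(x^{n+1})` in terms of the true
energy decrease plus quadratic terms of successive differences. -/
theorem stmt3 {X : Type*} [NormedAddCommGroup X] [InnerProductSpace ℝ X]
    [FiniteDimensional ℝ X]
    (δt α L : ℝ) (hδt : 0 < δt) (hα : 0 < α) (hL : 0 ≤ L)
    (H F : X → ℝ) (hH : ConvexOn ℝ Set.univ H)
    (f : X → X) (hF : ∀ x : X, HasGradientAt F (f x) x)
    (hf : ∀ x y : X, ‖f x - f y‖ ≤ L * ‖x - y‖)
    (xn2 xn1 xn xs : X)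
    (E Hn Fn En : X → ℝ)
    (hE : ∀ x, E x = H x + F x)
    (hHn : ∀ x, Hn x = H x + (1 / δt) * ‖x - xn‖ ^ 2)
    (hFn : ∀ x, Fn x = (α / δt) * ‖x - xn‖ ^ 2 + (14 / (11 * δt)) * ⟪x - xn, xn - xn1⟫
      - (4 / (11 * δt)) * ⟪x - xn1, xn1 - xn2⟫ - F x
      - 2 * ⟪f xn - f xn1, x - xn1⟫ + ⟪f xn1 - f xn2, x - xn2⟫)
    (hEn : ∀ x, En x = Hn x - Fn x) :
    En xn - En xs ≤ E xn - E xs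
      + ((11 * α - 2) / (11 * δt) + (3 / 2) * L) * ‖xs - xn‖ ^ 2
      + (7 / (11 * δt) + L) * ‖xn - xn1‖ ^ 2
      + (2 / (11 * δt) + L / 2) * ‖xn1 - xn2‖ ^ 2 := by
  have hg := abs_le.1 (abs_inner_le_of_norm_le_mul hL (hf xn xn1) (xs - xn))
  have hh := abs_le.1 (abs_inner_le_of_norm_le_mul hL (hf xn1 xn2) (xs - xn))
  have ha := abs_le.1 (abs_inner_le_of_norm_le_mul zero_le_one
    (one_mul ‖xs - xn‖).ge (xn - xn1))
  have hb := abs_le.1 (abs_inner_le_of_norm_le_mul zero_le_one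
    (one_mul ‖xs - xn‖).ge (xn1 - xn2))
  have e₁ : xs - xn1 = (xs - xn) + (xn - xn1) := by abel
  have e₂ : xs - xn2 = (xs - xn) + (xn - xn2) := by abel
  simp only [hEn, hHn, hFn, hE, e₁, e₂, inner_add_left, inner_add_right, sub_self, norm_zero,
    inner_zero_left]
  have hc : 0 ≤ 1 / (11 * δt) := by positivity
  have ha' := mul_le_mul_of_nonneg_left ha.2 hc
  have hb' := mul_le_mul_of_nonneg_left hb.1 hc
  have r₁ : 1 / δt = 11 * (1 / (11 * δt)) := by field_simp
  have r₂ : α / δt = 11 * α * (1 / (11 * δt)) := by field_simp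
  have r (c : ℝ) : c / (11 * δt) = c * (1 / (11 * δt)) := div_eq_mul_one_div _ _
  rw [r₁, r₂, r 14, r 4, r (11 * α - 2), r 7, r 2]
  linarith [hg.1, hh.2]
end

section
/- Assume the setup below, fix points x^{n-2}, x^{n-1}, x^n ∈ X and β ∈ [0,1), set y^n = x^n + β(x^n − x^{n-1}), and suppose x^{n+1} ∈ X satisfies the implicit-explicit optimality condition with subgradient w. Then ((1 − β)/2) ‖x^{n+1} − x^n‖_M² + (4/(11 δt) − (7/2) L) ‖x^{n+1} − x^n‖² ≤ A(x^n, x^{n-1}, x^{n-2}) − A(x^{n+1}, x^n, x^{n-1}). -/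
open scoped RealInnerProductSpace

/-- The descent lemma: a function with `L`-Lipschitz gradient lies below its quadratic model. -/
theorem le_quadratic_of_lipschitz_gradient {X : Type*} [NormedAddCommGroup X]
    [InnerProductSpace ℝ X] [CompleteSpace X] {F : X → ℝ} {f : X → X} {L : ℝ}
    (hF : ∀ x, HasGradientAt F (f x) x) (hf : ∀ x y, ‖f x - f y‖ ≤ L * ‖x - y‖) (x v : X) :
    F (x + v) ≤ F x + ⟪f x, v⟫ + L / 2 * ‖v‖ ^ 2 := by
  let g : ℝ → ℝ := fun t => F (x + t • v) - t * ⟪f x, v⟫ - L / 2 * ‖v‖ ^ 2 * t ^ 2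
  have hg : ∀ t, HasDerivAt g (⟪f (x + t • v), v⟫ - ⟪f x, v⟫ - L * ‖v‖ ^ 2 * t) t := by
    intro t
    have hline : HasDerivAt (fun t : ℝ => x + t • v) v t := by
      simpa using ((hasDerivAt_id t).smul_const v).const_add x
    have hFline := (hF (x + t • v)).hasFDerivAt.comp_hasDerivAt t hline
    refine ((hFline.sub ((hasDerivAt_id t).mul_const ⟪f x, v⟫)).sub
      (((hasDerivAt_id t).pow 2).const_mul (L / 2 * ‖v‖ ^ 2))).congr_deriv ?_
    simp
    ring
  have hanti : AntitoneOn g (Set.Icc 0 1) := by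
    refine antitoneOn_of_deriv_nonpos (convex_Icc 0 1)
      (fun t _ => (hg t).continuousAt.continuousWithinAt)
      (fun t _ => (hg t).differentiableAt.differentiableWithinAt) fun t ht => ?_
    rw [interior_Icc] at ht
    rw [(hg t).deriv, ← inner_sub_left]
    have hlip : ‖f (x + t • v) - f x‖ ≤ L * (t * ‖v‖) := by
      simpa [norm_smul, abs_of_pos ht.1] using hf (x + t • v) x
    have hinner := real_inner_le_norm (f (x + t • v) - f x) v
    nlinarith [mul_le_mul_of_nonneg_right hlip (norm_nonneg v)]
  have h := hanti (Set.left_mem_Icc.2 zero_le_one) (Set.right_mem_Icc.2 zero_le_one) zero_le_one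
  simp only [g, one_smul, zero_smul, add_zero] at h
  linarith

theorem two_mul_inner_le_of_norm_le {X : Type*} [NormedAddCommGroup X] [InnerProductSpace ℝ X]
    {L : ℝ} (hL : 0 ≤ L) {u v : X} (hu : ‖u‖ ≤ L * ‖v‖) (a : X) :
    2 * ⟪u, a⟫ ≤ L * (‖v‖ ^ 2 + ‖a‖ ^ 2) := by
  nlinarith [real_inner_le_norm u a, mul_le_mul_of_nonneg_right hu (norm_nonneg a),
    mul_nonneg hL (sq_nonneg (‖v‖ - ‖a‖))]

theorem two_mul_inner_map_le {X : Type*} [NormedAddCommGroup X] [InnerProductSpace ℝ X]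
    {M : X →ₗ[ℝ] X} (hM_sym : ∀ u v : X, ⟪M u, v⟫ = ⟪u, M v⟫)
    (hM_psd : ∀ v : X, 0 ≤ ⟪M v, v⟫) (a b : X) :
    2 * ⟪M b, a⟫ ≤ ⟪M a, a⟫ + ⟪M b, b⟫ := by
  have h := hM_psd (a - b)
  simp only [map_sub, inner_sub_left, inner_sub_right] at h
  linarith [hM_sym a b, real_inner_comm a (M b)]

/-- descent of the Lyapunov function `A` along the
implicit-explicit step with extrapolation. -/
theorem stmt4 {X : Type*} [NormedAddCommGroup X] [InnerProductSpace ℝ X]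
    [FiniteDimensional ℝ X]
    (δt α L : ℝ) (hδt : 0 < δt) (hα : 0 < α) (hL : 0 ≤ L)
    (H F : X → ℝ) (hH : ConvexOn ℝ Set.univ H)
    (f : X → X) (hF : ∀ x : X, HasGradientAt F (f x) x)
    (hf : ∀ x y : X, ‖f x - f y‖ ≤ L * ‖x - y‖)
    (M : X →ₗ[ℝ] X)
    (hM_sym : ∀ u v : X, ⟪M u, v⟫ = ⟪u, M v⟫)
    (hM_psd : ∀ v : X, 0 ≤ ⟪M v, v⟫)
    (E : X → ℝ) (hE : ∀ x, E x = H x + F x)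
    (A : X → X → X → ℝ)
    (hA : ∀ x y z : X, A x y z = E x + (9 / (11 * δt) + 3 * L / 2) * ‖x - y‖ ^ 2
      + (2 / (11 * δt) + L / 2) * ‖y - z‖ ^ 2 + (1 / 2) * ⟪M (x - y), x - y⟫)
    (xn2 xn1 xn : X) (β : ℝ) (hβ : β ∈ Set.Ico (0 : ℝ) 1)
    (yn : X) (hyn : yn = xn + β • (xn - xn1))
    (xs w : X)
    (hw : ∀ z : X, H z ≥ H xs + ⟪w, z - xs⟫)
    (hopt : (12 / (11 * δt)) • ((11 / 6 : ℝ) • xs - (3 : ℝ) • xn + (3 / 2 : ℝ) • xn1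
        - (1 / 3 : ℝ) • xn2) + M (xs - yn) + w
        + (3 : ℝ) • f xn - (3 : ℝ) • f xn1 + f xn2 = 0) :
    ((1 - β) / 2) * ⟪M (xs - xn), xs - xn⟫
      + (4 / (11 * δt) - (7 / 2) * L) * ‖xs - xn‖ ^ 2
      ≤ A xn xn1 xn2 - A xs xn xn1 := by
  obtain ⟨hβ0, hβ1⟩ := hβ
  obtain ⟨a, ha⟩ : ∃ a, a = xs - xn := ⟨_, rfl⟩
  obtain ⟨b, hb⟩ : ∃ b, b = xn - xn1 := ⟨_, rfl⟩
  obtain ⟨c, hc⟩ : ∃ c, c = xn1 - xn2 := ⟨_, rfl⟩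
  have hxs : xs = xn + a := by rw [ha]; abel
  have hFdesc := le_quadratic_of_lipschitz_gradient hF hf xn a
  rw [← hxs] at hFdesc
  have hHsub := hw xn
  rw [show xn - xs = -a by rw [ha]; abel, inner_neg_right] at hHsub
  have hfb := two_mul_inner_le_of_norm_le hL (u := f xn1 - f xn) (v := b)
    (by rw [norm_sub_rev, hb]; exact hf xn xn1) a
  have hfc := two_mul_inner_le_of_norm_le hL (u := f xn1 - f xn2) (v := c)
    (by rw [hc]; exact hf xn1 xn2) a
  have hMab := mul_le_mul_of_nonneg_left (two_mul_inner_map_le hM_sym hM_psd a b) hβ0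
  have hD : (11 / 6 : ℝ) • xs - (3 : ℝ) • xn + (3 / 2 : ℝ) • xn1 - (1 / 3 : ℝ) • xn2
      = (11 / 6 : ℝ) • a - (7 / 6 : ℝ) • b + (1 / 3 : ℝ) • c := by
    rw [ha, hb, hc]
    module
  have hy : xs - yn = a - β • b := by
    rw [hyn, ha, hb]
    abel
  rw [hD, hy] at hopt
  have hinner := congrArg (fun u => ⟪u, a⟫) hopt
  simp only [inner_add_left, inner_sub_left, real_inner_smul_left, map_sub, map_smul,
    inner_zero_left, real_inner_self_eq_norm_sq] at hinner
  simp only [inner_sub_left] at hfb hfc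
  have hab := norm_sub_sq_real b a
  have hac := norm_add_sq_real c a
  obtain ⟨k, hk⟩ : ∃ k, k = 1 / (11 * δt) := ⟨_, rfl⟩
  have hk0 : 0 ≤ k := by rw [hk]; positivity
  have hdiv (r : ℝ) : r / (11 * δt) = r * k := by rw [hk]; ring
  have hkab := mul_nonneg hk0 (sq_nonneg ‖b - a‖)
  have hkac := mul_nonneg hk0 (sq_nonneg ‖c + a‖)
  rw [hab] at hkab
  rw [hac] at hkac
  rw [hdiv] at hinner
  rw [hA, hA, hE, hE, ← ha, ← hb, ← hc]
  simp only [hdiv]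
  have hMβ := mul_nonneg (sub_nonneg.2 hβ1.le) (hM_psd b)
  linarith
end

section
/- Assume the setup below with L > 0 and δt < 8/(77 L), and suppose E = H + F is bounded below on X. Let x : ℕ → X, β : ℕ → [0,1) with sup_n β_n < 1, and suppose that for every n ≥ 2 the point x_{n+1} satisfies the implicit-explicit optimality condition (with data x_n, x_{n-1}, x_{n-2}, y_n = x_n + β_n(x_n − x_{n-1}) and some subgradient w_{n+1} of H at x_{n+1}). Then the sequence of successive differences is square summable: ∑_{n=1}^{∞} ‖x_{n+1} − x_n‖² < ∞. -/
open scoped RealInnerProductSpace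

/-- The descent lemma: a function with `L`-Lipschitz gradient is bounded above by its quadratic
model. -/
theorem descent_of_lipschitz_gradient {X : Type*} [NormedAddCommGroup X] [InnerProductSpace ℝ X]
    [CompleteSpace X] {L : ℝ} {F : X → ℝ} {f : X → X} (hF : ∀ x : X, HasGradientAt F (f x) x)
    (hf : ∀ x y : X, ‖f x - f y‖ ≤ L * ‖x - y‖) (x v : X) :
    F (x + v) ≤ F x + ⟪f x, v⟫ + L / 2 * ‖v‖ ^ 2 := by
  have hderiv : ∀ t : ℝ, HasDerivAt
      (fun t : ℝ => F (x + t • v) - t * ⟪f x, v⟫ - L / 2 * ‖v‖ ^ 2 * t ^ 2)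
      (⟪f (x + t • v), v⟫ - ⟪f x, v⟫ - L * ‖v‖ ^ 2 * t) t := by
    intro t
    have hline : HasDerivAt (fun t : ℝ => x + t • v) v t := by
      simpa using ((hasDerivAt_id t).smul_const v).const_add x
    have hcomp := (hF (x + t • v)).hasFDerivAt.comp_hasDerivAt t hline
    rw [InnerProductSpace.toDual_apply_apply] at hcomp
    have hlin := (hasDerivAt_id t).mul_const ⟪f x, v⟫
    have hquad := ((hasDerivAt_id t).pow 2).const_mul (L / 2 * ‖v‖ ^ 2)
    refine ((hcomp.sub hlin).sub hquad).congr_deriv ?_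
    simp
    ring
  have hanti : AntitoneOn
      (fun t : ℝ => F (x + t • v) - t * ⟪f x, v⟫ - L / 2 * ‖v‖ ^ 2 * t ^ 2) (Set.Ici 0) := by
    refine antitoneOn_of_deriv_nonpos (convex_Ici 0)
      (fun t _ => (hderiv t).continuousAt.continuousWithinAt)
      (fun t _ => (hderiv t).differentiableAt.differentiableWithinAt) ?_
    intro t ht
    rw [interior_Ici, Set.mem_Ioi] at ht
    rw [(hderiv t).deriv, ← inner_sub_left]
    have hlip := hf (x + t • v) x
    rw [add_sub_cancel_left, norm_smul, Real.norm_of_nonneg ht.le] at hlip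
    have hcs := real_inner_le_norm (f (x + t • v) - f x) v
    nlinarith [mul_le_mul_of_nonneg_right hlip (norm_nonneg v)]
  have h := hanti (Set.mem_Ici.2 le_rfl) (Set.mem_Ici.2 zero_le_one) zero_le_one
  simp at h
  linarith

/-- One-step energy estimate for the scheme, written in terms of consecutive increments `d`, `p`,
`q`, where `u` and `v` are the corresponding gradient increments. -/
theorem energy_step_le {X : Type*} [NormedAddCommGroup X] [InnerProductSpace ℝ X]
    {k L β : ℝ} (hk : 0 ≤ k) (hβ : β ∈ Set.Ico (0 : ℝ) 1) (M : X →ₗ[ℝ] X)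
    (hM_sym : ∀ u v : X, ⟪M u, v⟫ = ⟪u, M v⟫) (hM_psd : ∀ v : X, 0 ≤ ⟪M v, v⟫)
    {d p q g u v w : X} (hu : ‖u‖ ≤ L * ‖p‖) (hv : ‖v‖ ≤ L * ‖q‖) (hL : 0 ≤ L)
    (hw : k • ((11 / 6 : ℝ) • d - (7 / 6 : ℝ) • p + (1 / 3 : ℝ) • q) + M (d - β • p) + w
      + g + (2 : ℝ) • u - v = 0) :
    ⟪w, d⟫ + ⟪g, d⟫ + (13 / 12 * k - 3 / 2 * L) * ‖d‖ ^ 2 + 1 / 2 * ⟪M d, d⟫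
      ≤ (7 / 12 * k + L) * ‖p‖ ^ 2 + (k / 6 + L / 2) * ‖q‖ ^ 2 + 1 / 2 * ⟪M p, p⟫ := by
  obtain ⟨hβ0, hβ1⟩ := hβ
  have htest := congrArg (fun z => ⟪z, d⟫) hw
  simp only [inner_add_left, inner_sub_left, real_inner_smul_left, map_sub, map_smul,
    inner_zero_left, real_inner_self_eq_norm_sq] at htest
  have hMpd := hM_psd (d - p)
  have hsym : ⟪M d, p⟫ = ⟪M p, d⟫ := by rw [hM_sym, real_inner_comm]
  simp only [map_sub, inner_sub_left, inner_sub_right, hsym] at hMpd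
  have hpd : ⟪p, d⟫ ≤ (‖p‖ ^ 2 + ‖d‖ ^ 2) / 2 := by
    nlinarith [real_inner_le_norm p d, sq_nonneg (‖p‖ - ‖d‖)]
  have hqd : -⟪q, d⟫ ≤ (‖q‖ ^ 2 + ‖d‖ ^ 2) / 2 := by
    nlinarith [neg_le_of_abs_le (abs_real_inner_le_norm q d), sq_nonneg (‖q‖ - ‖d‖)]
  have hud : -⟪u, d⟫ ≤ L * ((‖p‖ ^ 2 + ‖d‖ ^ 2) / 2) := by
    nlinarith [neg_le_of_abs_le (abs_real_inner_le_norm u d),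
      mul_le_mul_of_nonneg_right hu (norm_nonneg d), mul_nonneg hL (sq_nonneg (‖p‖ - ‖d‖))]
  have hvd : ⟪v, d⟫ ≤ L * ((‖q‖ ^ 2 + ‖d‖ ^ 2) / 2) := by
    nlinarith [real_inner_le_norm v d,
      mul_le_mul_of_nonneg_right hv (norm_nonneg d), mul_nonneg hL (sq_nonneg (‖q‖ - ‖d‖))]
  have hcross : β * ⟪M p, d⟫ ≤ 1 / 2 * ⟪M d, d⟫ + 1 / 2 * ⟪M p, p⟫ := by
    nlinarith [mul_nonneg hβ0 hMpd, mul_nonneg (sub_nonneg.2 hβ1.le) (hM_psd d),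
      mul_nonneg (sub_nonneg.2 hβ1.le) (hM_psd p)]
  nlinarith [mul_le_mul_of_nonneg_left hpd hk, mul_le_mul_of_nonneg_left hqd hk]

/-- If a sequence bounded below drops by at least `a n ≥ 0` at each step, then `a` is summable. -/
theorem summable_of_le_sub_succ {a φ : ℕ → ℝ} {c : ℝ} (ha : ∀ n, 0 ≤ a n) (hφ : ∀ n, c ≤ φ n)
    (h : ∀ n, a n ≤ φ n - φ (n + 1)) : Summable a := by
  refine summable_of_sum_range_le (c := φ 0 - c) ha fun n => ?_
  have hsum := Finset.sum_le_sum fun i (_ : i ∈ Finset.range n) => h i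
  rw [Finset.sum_range_sub'] at hsum
  linarith [hφ n]

/-- square summability of the successive differences of the
iterates of the preconditioned third-order implicit-explicit scheme with
extrapolation, when `δt < 8/(77 L)` and `E = H + F` is bounded below. -/
theorem stmt5 {X : Type*} [NormedAddCommGroup X] [InnerProductSpace ℝ X]
    [FiniteDimensional ℝ X]
    (δt α L : ℝ) (hδt : 0 < δt) (hα : 0 < α) (hL : 0 < L)
    (hδtL : δt < 8 / (77 * L))
    (H F : X → ℝ) (hH : ConvexOn ℝ Set.univ H)
    (f : X → X) (hF : ∀ x : X, HasGradientAt F (f x) x)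
    (hf : ∀ x y : X, ‖f x - f y‖ ≤ L * ‖x - y‖)
    (M : X →ₗ[ℝ] X)
    (hM_sym : ∀ u v : X, ⟪M u, v⟫ = ⟪u, M v⟫)
    (hM_psd : ∀ v : X, 0 ≤ ⟪M v, v⟫)
    (hbdd : ∃ c : ℝ, ∀ x : X, c ≤ H x + F x)
    (x : ℕ → X) (β : ℕ → ℝ)
    (hβ : ∀ n, β n ∈ Set.Ico (0 : ℝ) 1)
    (hβsup : ∃ b < (1 : ℝ), ∀ n, β n ≤ b)
    (hstep : ∀ n, 2 ≤ n → ∃ w : X,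
      (∀ z : X, H z ≥ H (x (n + 1)) + ⟪w, z - x (n + 1)⟫) ∧
      (12 / (11 * δt)) • ((11 / 6 : ℝ) • x (n + 1) - (3 : ℝ) • x n
          + (3 / 2 : ℝ) • x (n - 1) - (1 / 3 : ℝ) • x (n - 2))
        + M (x (n + 1) - (x n + (β n) • (x n - x (n - 1)))) + w
        + (3 : ℝ) • f (x n) - (3 : ℝ) • f (x (n - 1)) + f (x (n - 2)) = 0) :
    Summable (fun n : ℕ => ‖x (n + 1) - x n‖ ^ 2) := by
  obtain ⟨c, hc⟩ := hbdd
  set k : ℝ := 12 / (11 * δt) with hk_def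
  have hk : 0 < k := by positivity
  have hgap : 0 < k / 3 - 7 / 2 * L := by
    have hprod : δt * (77 * L) < 8 := (lt_div_iff₀ (by positivity)).1 hδtL
    have hkδ : k * δt = 12 / 11 := by rw [hk_def]; field_simp
    by_contra! hle
    nlinarith [mul_le_mul_of_nonneg_right hle hδt.le]
  let φ : ℕ → ℝ := fun n => H (x (n + 2)) + F (x (n + 2))
    + (3 / 4 * k + 3 / 2 * L) * ‖x (n + 2) - x (n + 1)‖ ^ 2
    + (k / 6 + L / 2) * ‖x (n + 1) - x n‖ ^ 2
    + 1 / 2 * ⟪M (x (n + 2) - x (n + 1)), x (n + 2) - x (n + 1)⟫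
  have hφ : ∀ n, c ≤ φ n := by
    intro n
    have hM := hM_psd (x (n + 2) - x (n + 1))
    have hE := hc (x (n + 2))
    have h1 : 0 ≤ (3 / 4 * k + 3 / 2 * L) * ‖x (n + 2) - x (n + 1)‖ ^ 2 := by positivity
    have h2 : 0 ≤ (k / 6 + L / 2) * ‖x (n + 1) - x n‖ ^ 2 := by positivity
    simp only [φ]
    linarith
  have hdrop : ∀ n, (k / 3 - 7 / 2 * L) * ‖x (n + 3) - x (n + 2)‖ ^ 2 ≤ φ n - φ (n + 1) := by
    intro n
    obtain ⟨w, hw, heq⟩ := hstep (n + 2) (by omega)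
    simp only [show n + 2 + 1 = n + 3 from rfl, show n + 2 - 1 = n + 1 from rfl,
      Nat.add_sub_cancel] at hw heq
    have hH := hw (x (n + 2))
    rw [← neg_sub (x (n + 3)), inner_neg_right] at hH
    have hFd := descent_of_lipschitz_gradient hF hf (x (n + 2)) (x (n + 3) - x (n + 2))
    rw [add_sub_cancel] at hFd
    have hscheme : k • ((11 / 6 : ℝ) • (x (n + 3) - x (n + 2))
          - (7 / 6 : ℝ) • (x (n + 2) - x (n + 1)) + (1 / 3 : ℝ) • (x (n + 1) - x n))
        + M ((x (n + 3) - x (n + 2)) - β (n + 2) • (x (n + 2) - x (n + 1))) + w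
        + f (x (n + 2)) + (2 : ℝ) • (f (x (n + 2)) - f (x (n + 1)))
        - (f (x (n + 1)) - f (x n)) = 0 := by
      rw [← heq, ← sub_sub (x (n + 3))]
      module
    have hE := energy_step_le hk.le (hβ (n + 2)) M hM_sym hM_psd (hf _ _) (hf _ _) hL.le hscheme
    simp only [φ, show n + 1 + 2 = n + 3 from rfl, show n + 1 + 1 = n + 2 from rfl]
    linarith
  have hsum := summable_of_le_sub_succ (fun n => by positivity) hφ hdrop
  rw [summable_mul_left_iff hgap.ne'] at hsum
  exact (summable_nat_add_iff 2).1 hsum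
end

section
/- Assume the setup below, fix points x^{n-2}, x^{n-1}, x^n ∈ X and β ∈ [0,1), set y^n = x^n + β(x^n − x^{n-1}), and suppose x^{n+1} ∈ X satisfies the implicit-explicit optimality condition with subgradient w. Set C₁ = 18/(11 δt) + 3L, C₂ = 4/(11 δt) + L, and let λ_M denote the operator norm of M. Then ‖w + f(x^{n+1}) + C₁(x^{n+1} − x^n) + M(x^{n+1} − x^n)‖ + ‖−C₁(x^{n+1} − x^n) − M(x^{n+1} − x^n) + C₂(x^n − x^{n-1})‖ + ‖C₂(x^n − x^{n-1})‖ ≤ (L + 2C₁ + 3λ_M + 2/δt) ‖x^{n+1} − x^n‖ + (2L + 2C₂ + 14/(11 δt) + λ_M β) ‖x^n − x^{n-1}‖ + (L + 4/(11 δt)) ‖x^{n-1} − x^{n-2}‖. -/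
open scoped RealInnerProductSpace

/-- bound on the subgradient of the Lyapunov function `A` at the
iterates in terms of the last three successive differences. -/
theorem stmt6 {X : Type*} [NormedAddCommGroup X] [InnerProductSpace ℝ X]
    [FiniteDimensional ℝ X]
    (δt L : ℝ) (hδt : 0 < δt) (hL : 0 ≤ L)
    (H : X → ℝ) (hH : ConvexOn ℝ Set.univ H)
    (f : X → X) (hf : ∀ x y : X, ‖f x - f y‖ ≤ L * ‖x - y‖)
    (M : X →L[ℝ] X)
    (hM_sym : ∀ u v : X, ⟪M u, v⟫ = ⟪u, M v⟫)
    (hM_psd : ∀ v : X, 0 ≤ ⟪M v, v⟫)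
    (xn2 xn1 xn : X) (β : ℝ) (hβ : β ∈ Set.Ico (0 : ℝ) 1)
    (yn : X) (hyn : yn = xn + β • (xn - xn1))
    (xs w : X)
    (hw : ∀ z : X, H z ≥ H xs + ⟪w, z - xs⟫)
    (hopt : (12 / (11 * δt)) • ((11 / 6 : ℝ) • xs - (3 : ℝ) • xn + (3 / 2 : ℝ) • xn1
        - (1 / 3 : ℝ) • xn2) + M (xs - yn) + w
        + (3 : ℝ) • f xn - (3 : ℝ) • f xn1 + f xn2 = 0)
    (C₁ C₂ : ℝ) (hC₁ : C₁ = 18 / (11 * δt) + 3 * L) (hC₂ : C₂ = 4 / (11 * δt) + L) :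
    ‖w + f xs + C₁ • (xs - xn) + M (xs - xn)‖
      + ‖-(C₁ • (xs - xn)) - M (xs - xn) + C₂ • (xn - xn1)‖
      + ‖C₂ • (xn - xn1)‖
    ≤ (L + 2 * C₁ + 3 * ‖M‖ + 2 / δt) * ‖xs - xn‖
      + (2 * L + 2 * C₂ + 14 / (11 * δt) + ‖M‖ * β) * ‖xn - xn1‖
      + (L + 4 / (11 * δt)) * ‖xn1 - xn2‖ := by
  have hM (v : X) : ‖M v‖ ≤ ‖M‖ * ‖v‖ := M.le_opNorm v
  have hC₁_nonneg : 0 ≤ C₁ := by rw [hC₁]; positivity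
  have hC₂_nonneg : 0 ≤ C₂ := by rw [hC₂]; positivity
  have residual : w + f xs + C₁ • (xs - xn) + M (xs - xn)
      = (f xs - f xn) - (2 : ℝ) • (f xn - f xn1) + (f xn1 - f xn2)
        + C₁ • (xs - xn) - (2 / δt) • (xs - xn) + (14 / (11 * δt)) • (xn - xn1)
        - (4 / (11 * δt)) • (xn1 - xn2) + β • M (xn - xn1) := by
    rw [← sub_eq_zero, ← hopt, hyn]
    simp only [map_sub, map_add, map_smul]
    match_scalars <;> field_simp <;> ring
  have first : ‖w + f xs + C₁ • (xs - xn) + M (xs - xn)‖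
      ≤ L * ‖xs - xn‖ + 2 * (L * ‖xn - xn1‖) + L * ‖xn1 - xn2‖
        + C₁ * ‖xs - xn‖ + 2 / δt * ‖xs - xn‖ + 14 / (11 * δt) * ‖xn - xn1‖
        + 4 / (11 * δt) * ‖xn1 - xn2‖ + β * (‖M‖ * ‖xn - xn1‖) := by
    rw [residual]
    refine norm_add_le_of_le (norm_sub_le_of_le (norm_add_le_of_le (norm_sub_le_of_le
      (norm_add_le_of_le (norm_add_le_of_le (norm_sub_le_of_le (hf _ _) ?_) (hf _ _))
      ?_) ?_) ?_) ?_) ?_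
    · rw [norm_smul_of_nonneg (by norm_num)]
      gcongr
      exact hf _ _
    · rw [norm_smul_of_nonneg hC₁_nonneg]
    · rw [norm_smul_of_nonneg (by positivity)]
    · rw [norm_smul_of_nonneg (by positivity)]
    · rw [norm_smul_of_nonneg (by positivity)]
    · rw [norm_smul_of_nonneg hβ.1]
      exact mul_le_mul_of_nonneg_left (hM _) hβ.1
  have second : ‖-(C₁ • (xs - xn)) - M (xs - xn) + C₂ • (xn - xn1)‖
      ≤ C₁ * ‖xs - xn‖ + ‖M‖ * ‖xs - xn‖ + C₂ * ‖xn - xn1‖ := by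
    refine norm_add_le_of_le (norm_sub_le_of_le ?_ (hM _)) ?_
    · rw [norm_neg, norm_smul_of_nonneg hC₁_nonneg]
    · rw [norm_smul_of_nonneg hC₂_nonneg]
  have third : ‖C₂ • (xn - xn1)‖ = C₂ * ‖xn - xn1‖ := norm_smul_of_nonneg hC₂_nonneg _
  have slack : 0 ≤ ‖M‖ * ‖xs - xn‖ := by positivity
  linarith
end

section
/- Let X be a finite-dimensional real inner product space, x : ℕ → X a sequence, and set ν_n = ‖x_{n+1} − x_n‖. Let (A_n) be a nonincreasing real sequence converging to ζ with A_n > ζ for all n. Let ν₀ > 0 and let ψ : [0, ν₀) → [0, ∞) be continuous and concave with ψ(0) = 0, differentiable with ψ' > 0 on (0, ν₀). Suppose there exist m > 0, C > 0 and T ≥ 2 such that for all n ≥ T: A_n − ζ < ν₀, A_n − A_{n+1} ≥ m ν_{n+1}², and ψ'(A_n − ζ) · C (ν_n + ν_{n-1} + ν_{n-2}) ≥ 1. Then ∑_{n=0}^{∞} ‖x_{n+1} − x_n‖ < ∞; in particular (x_n) is a Cauchy sequence and converges. -/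
/-- A concave function lies below its tangent lines. -/
theorem deriv_mul_sub_le_sub_of_concaveOn {f : ℝ → ℝ} {S : Set ℝ} (hf : ConcaveOn ℝ S f)
    {a b : ℝ} (ha : a ∈ S) (hb : b ∈ S) (hab : a ≤ b) (hd : DifferentiableAt ℝ f b) :
    deriv f b * (b - a) ≤ f b - f a := by
  rcases hab.eq_or_lt with rfl | hlt
  · simp
  · have h := hf.deriv_le_slope ha hb hlt hd
    rwa [slope_def_field, le_div_iff₀ (sub_pos.2 hlt)] at h

/-- If `d * (C * S) ≥ 1` and `d * (m * v ^ 2) ≤ D`, then `v` is controlled by `S` and `D`. -/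
theorem four_mul_le_add_of_deriv_bounds {d C m S v D : ℝ} (hd : 0 < d) (hC : 0 < C) (hm : 0 < m)
    (hS : 1 ≤ d * (C * S)) (hD : d * (m * v ^ 2) ≤ D) :
    4 * v ≤ S + 4 * (C / m) * D := by
  have hCS : 0 < C * S := pos_of_mul_pos_right (one_pos.trans_le hS) hd.le
  have hS0 : 0 < S := pos_of_mul_pos_right hCS hC.le
  have hD0 : 0 ≤ D := le_trans (by positivity) hD
  have key : v ^ 2 ≤ S * (C / m * D) := by
    rw [show S * (C / m * D) = C * S * D / m by ring, le_div_iff₀ hm]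
    calc v ^ 2 * m = 1 * (m * v ^ 2) := by ring
      _ ≤ d * (C * S) * (m * v ^ 2) := by gcongr
      _ = C * S * (d * (m * v ^ 2)) := by ring
      _ ≤ C * S * D := by gcongr
  have hK : 0 ≤ C / m * D := by positivity
  have := abs_le_of_sq_le_sq (a := 4 * v) (b := S + 4 * (C / m * D))
    (by nlinarith [sq_nonneg (S - 4 * (C / m * D))]) (by positivity)
  linarith [le_abs_self (4 * v)]

/-- A nonnegative sequence is summable if its terms are eventually dominated by a quarter of the
sum of the three preceding ones plus a telescoping term bounded below. -/
theorem summable_of_four_mul_le_add_sub {ν φ : ℕ → ℝ} {T : ℕ} (hT : 2 ≤ T) (hν : ∀ n, 0 ≤ ν n)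
    (hφ : ∀ n, T ≤ n → 0 ≤ φ n)
    (h : ∀ n, T ≤ n → 4 * ν (n + 1) ≤ ν n + ν (n - 1) + ν (n - 2) + (φ n - φ (n + 1))) :
    Summable ν := by
  let L : ℕ → ℝ := fun n => 3 * ν n + 2 * ν (n - 1) + ν (n - 2) + φ n
  have hL : ∀ n, T ≤ n → 0 ≤ L n := fun n hn => by
    have := hν n
    have := hν (n - 1)
    have := hν (n - 2)
    have := hφ n hn
    positivity
  have hstep : ∀ n, T ≤ n → ν (n + 1) ≤ L n - L (n + 1) := fun n hn => by
    have := h n hn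
    simp only [L, Nat.add_sub_cancel, show n + 1 - 2 = n - 1 by omega]
    linarith
  refine (summable_nat_add_iff (T + 1)).1
    (summable_of_sum_range_le (c := L T) (fun n => hν _) fun N => ?_)
  have hsum : ∑ i ∈ Finset.range N, ν (i + (T + 1)) ≤ L T - L (T + N) := by
    induction N with
    | zero => simp
    | succ k ih =>
      rw [Finset.sum_range_succ]
      have := hstep (T + k) (by omega)
      rw [show k + (T + 1) = T + k + 1 by omega, ← add_assoc]
      linarith
  linarith [hL (T + N) (by omega)]

/-- sequence-level core of the global convergence theorem: the
Lyapunov descent estimate combined with the Kurdyka-Łojasiewicz inequality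
implies finite length, hence convergence, of the iterate sequence. -/
theorem stmt10 {X : Type*} [NormedAddCommGroup X] [InnerProductSpace ℝ X]
    [FiniteDimensional ℝ X]
    (x : ℕ → X) (ν : ℕ → ℝ) (hν : ∀ n, ν n = ‖x (n + 1) - x n‖)
    (A : ℕ → ℝ) (ζ : ℝ) (hA : Antitone A)
    (hAlim : Filter.Tendsto A Filter.atTop (nhds ζ))
    (hAgt : ∀ n, ζ < A n)
    (ν₀ : ℝ) (hν₀ : 0 < ν₀) (ψ : ℝ → ℝ)
    (hψcont : ContinuousOn ψ (Set.Ico 0 ν₀))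
    (hψconc : ConcaveOn ℝ (Set.Ico 0 ν₀) ψ)
    (hψ0 : ψ 0 = 0)
    (hψnonneg : ∀ s ∈ Set.Ico (0 : ℝ) ν₀, 0 ≤ ψ s)
    (hψdiff : ∀ s ∈ Set.Ioo (0 : ℝ) ν₀, DifferentiableAt ℝ ψ s)
    (hψ' : ∀ s ∈ Set.Ioo (0 : ℝ) ν₀, 0 < deriv ψ s)
    (m C : ℝ) (hm : 0 < m) (hC : 0 < C) (T : ℕ) (hT : 2 ≤ T)
    (h1 : ∀ n, T ≤ n → A n - ζ < ν₀)
    (h2 : ∀ n, T ≤ n → A n - A (n + 1) ≥ m * (ν (n + 1)) ^ 2)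
    (h3 : ∀ n, T ≤ n → deriv ψ (A n - ζ) * (C * (ν n + ν (n - 1) + ν (n - 2))) ≥ 1) :
    Summable (fun n : ℕ => ‖x (n + 1) - x n‖) ∧ CauchySeq x ∧
      ∃ xstar : X, Filter.Tendsto x Filter.atTop (nhds xstar) := by
  have hmem : ∀ n, T ≤ n → A n - ζ ∈ Set.Ioo 0 ν₀ := fun n hn =>
    ⟨sub_pos.2 (hAgt n), h1 n hn⟩
  have hsum : Summable ν := by
    refine summable_of_four_mul_le_add_sub (φ := fun n => 4 * (C / m) * ψ (A n - ζ)) hT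
      (fun n => hν n ▸ norm_nonneg _) (fun n hn => ?_) (fun n hn => ?_)
    · have := hψnonneg _ (Set.Ioo_subset_Ico_self (hmem n hn))
      positivity
    · have hs := hmem n hn
      have htan := deriv_mul_sub_le_sub_of_concaveOn hψconc
        (Set.Ioo_subset_Ico_self (hmem (n + 1) (by omega))) (Set.Ioo_subset_Ico_self hs)
        (sub_le_sub_right (hA n.le_succ) ζ) (hψdiff _ hs)
      rw [sub_sub_sub_cancel_right] at htan
      have hdesc := (mul_le_mul_of_nonneg_left (h2 n hn) (hψ' _ hs).le).trans htan
      have := four_mul_le_add_of_deriv_bounds (hψ' _ hs) hC hm (h3 n hn) hdesc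
      linarith
  have hsum' : Summable fun n => ‖x (n + 1) - x n‖ := hsum.congr hν
  have hcauchy : CauchySeq x := cauchySeq_of_summable_dist <| by
    simpa only [dist_eq_norm, norm_sub_rev] using hsum'
  have : CompleteSpace X := FiniteDimensional.complete ℝ X
  exact ⟨hsum', hcauchy, cauchySeq_tendsto_of_complete hcauchy⟩
end

section
/- Let (A_n) be a nonincreasing real sequence converging to ζ, let (D_n) be a sequence of nonnegative reals with D_n → 0, let c > 0, and let (ν_n) be a sequence of nonnegative reals. Suppose that for every n, if A_n > ζ then c · D_n ≥ 1, and that there exists m > 0 with m ν_{n+1}² ≤ A_n − A_{n+1} for all n. Then there exists n₀ such that ν_n = 0 for all n > n₀. -/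
/-- the `θ = 0` case of the local convergence theorem: the
Kurdyka-Łojasiewicz inequality with linear desingularizing function forces the
successive differences to vanish after finitely many steps. -/
theorem stmt11 (A : ℕ → ℝ) (ζ : ℝ) (hA : Antitone A)
    (hAlim : Filter.Tendsto A Filter.atTop (nhds ζ))
    (D : ℕ → ℝ) (hD : ∀ n, 0 ≤ D n)
    (hDlim : Filter.Tendsto D Filter.atTop (nhds 0))
    (c : ℝ) (hc : 0 < c) (ν : ℕ → ℝ) (hν : ∀ n, 0 ≤ ν n)
    (hKL : ∀ n, ζ < A n → c * D n ≥ 1)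
    (m : ℝ) (hm : 0 < m)
    (hdesc : ∀ n, m * (ν (n + 1)) ^ 2 ≤ A n - A (n + 1)) :
    ∃ n₀ : ℕ, ∀ n, n₀ < n → ν n = 0 := by
  have hcD : Filter.Tendsto (fun n => c * D n) Filter.atTop (nhds 0) := by
    simpa using hDlim.const_mul c
  obtain ⟨N, hN⟩ := Filter.eventually_atTop.1 (hcD.eventually_lt_const one_pos)
  have hAN : ∀ n, N ≤ n → A n = ζ := fun n hn =>
    le_antisymm (not_lt.1 fun h => (hN n hn).not_ge (hKL n h)) (hA.le_of_tendsto hAlim n)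
  refine ⟨N, fun n hn => ?_⟩
  obtain ⟨k, rfl⟩ : ∃ k, n = k + 1 := ⟨n - 1, by omega⟩
  have hk := hdesc k
  rw [hAN k (by omega), hAN (k + 1) hn.le, sub_self] at hk
  exact pow_eq_zero_iff two_ne_zero |>.1 <|
    le_antisymm (nonpos_of_mul_nonpos_right hk hm) (sq_nonneg _)
end

section
/- Let θ ∈ (0, 1/2], C₁ > 0, and let (S_n) be a nonincreasing sequence of nonnegative reals such that for some N ≥ 2 and all n ≥ N, S_n ≤ C₁ (S_{n-2} − S_{n+1})^{(1−θ)/θ} + 2 (S_{n-2} − S_{n+1}). Then there exist c > 0 and η ∈ (0, 1) such that S_n ≤ c η^n for all n. -/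
/-- A bounded nonnegative base raised to a power at least one is controlled linearly. -/
theorem rpow_le_rpow_sub_one_mul {d M p : ℝ} (hd : 0 ≤ d) (hdM : d ≤ M) (hp : 1 ≤ p) :
    d ^ p ≤ M ^ (p - 1) * d := by
  rcases hd.eq_or_lt with rfl | hpos
  · simp [Real.zero_rpow (by linarith : p ≠ 0)]
  · calc d ^ p = d ^ (p - 1) * d := by
          rw [← Real.rpow_add_one hpos.ne', sub_add_cancel]
      _ ≤ M ^ (p - 1) * d := by
          gcongr

/-- A nonincreasing nonnegative sequence that eventually contracts by a fixed factor every
`k` steps converges to zero R-linearly. -/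
theorem exists_le_mul_pow_of_contracting {S : ℕ → ℝ} (hS : ∀ n, 0 ≤ S n) (hSmono : Antitone S)
    {q : ℝ} (hq : 0 < q) (hq1 : q < 1) {k : ℕ} (hk : k ≠ 0) {N : ℕ}
    (hstep : ∀ m, N ≤ m → S (m + k) ≤ q * S m) :
    ∃ c > (0 : ℝ), ∃ η ∈ Set.Ioo (0 : ℝ) 1, ∀ n : ℕ, S n ≤ c * η ^ n := by
  set η : ℝ := q ^ ((k : ℝ)⁻¹) with hη
  have hη0 : 0 < η := Real.rpow_pos_of_pos hq _
  have hη1 : η < 1 := Real.rpow_lt_one hq.le hq1 (by positivity)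
  have hηk : η ^ k = q := Real.rpow_inv_natCast_pow hq.le hk
  have hS0 := hS 0
  refine ⟨(S 0 + 1) / η ^ (N + k), by positivity, η, ⟨hη0, hη1⟩, fun n => ?_⟩
  induction n using Nat.strong_induction_on with
  | _ n ih =>
    rcases le_total n (N + k) with hn | hn
    · have hpow : η ^ (N + k) ≤ η ^ n := pow_le_pow_of_le_one hη0.le hη1.le hn
      rw [div_mul_eq_mul_div, le_div_iff₀ (by positivity)]
      exact mul_le_mul (by linarith [hSmono (Nat.zero_le n)]) hpow (by positivity) (by positivity)
    · obtain ⟨m, rfl⟩ : ∃ m, n = m + k := ⟨n - k, by omega⟩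
      calc S (m + k) ≤ q * S m := hstep m (by omega)
        _ ≤ q * ((S 0 + 1) / η ^ (N + k) * η ^ m) := by
            gcongr
            exact ih m (by omega)
        _ = (S 0 + 1) / η ^ (N + k) * η ^ (m + k) := by
            rw [pow_add η m k, hηk]
            ring

/-- the `θ ∈ (0, 1/2]` case of the local convergence rate:
the tail-length recursion forces R-linear convergence `S_n ≤ c η^n`. -/
theorem stmt12 (θ C₁ : ℝ) (hθ : θ ∈ Set.Ioc (0 : ℝ) (1 / 2)) (hC₁ : 0 < C₁)
    (S : ℕ → ℝ) (hS : ∀ n, 0 ≤ S n) (hSmono : Antitone S)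
    (N : ℕ) (hN : 2 ≤ N)
    (hrec : ∀ n, N ≤ n →
      S n ≤ C₁ * (S (n - 2) - S (n + 1)) ^ ((1 - θ) / θ) + 2 * (S (n - 2) - S (n + 1))) :
    ∃ c > (0 : ℝ), ∃ η ∈ Set.Ioo (0 : ℝ) 1, ∀ n : ℕ, S n ≤ c * η ^ n := by
  obtain ⟨hθ0, hθ1⟩ := hθ
  have hp : 1 ≤ (1 - θ) / θ := by
    rw [le_div_iff₀ hθ0]
    linarith
  set p := (1 - θ) / θ
  set K : ℝ := C₁ * S 0 ^ (p - 1) + 2 with hK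
  have hKpos : 0 < K := by
    have := Real.rpow_nonneg (hS 0) (p - 1)
    positivity
  refine exists_le_mul_pow_of_contracting hS hSmono (q := K / (1 + K)) (k := 3) (N := N)
    (by positivity) ((div_lt_one (by positivity)).2 (by linarith)) (by norm_num) fun m hm => ?_
  have hr := hrec (m + 2) (by omega)
  simp only [Nat.add_sub_cancel, Nat.add_assoc, Nat.reduceAdd] at hr
  have hd : 0 ≤ S m - S (m + 3) := sub_nonneg.2 (hSmono (by omega))
  have hdM : S m - S (m + 3) ≤ S 0 := by linarith [hSmono (Nat.zero_le m), hS (m + 3)]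
  have hpow := mul_le_mul_of_nonneg_left (rpow_le_rpow_sub_one_mul hd hdM hp) hC₁.le
  have hmono : S (m + 3) ≤ S (m + 2) := hSmono (by omega)
  have hlin : S (m + 3) ≤ K * (S m - S (m + 3)) := by
    rw [hK, add_mul, mul_assoc]
    linarith
  rw [div_mul_eq_mul_div, le_div_iff₀ (by positivity)]
  linarith
end

section
/- Let θ ∈ (1/2, 1), C₂ > 0, and let (S_n) be a nonincreasing sequence of nonnegative reals such that for some N ≥ 2 and all n ≥ N, S_{n+1}^{θ/(1−θ)} ≤ C₂ (S_{n-2} − S_{n+1}). Then there exists C > 0 such that S_n ≤ C n^{−(1−θ)/(2θ−1)} for all n ≥ 1. -/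
/-- An elementary upper bound of Bernoulli type, valid for every nonnegative exponent. -/
theorem one_add_rpow_le_one_add_mul_exp {x r : ℝ} (hx : 0 ≤ x) (hr : 0 ≤ r) :
    (1 + x) ^ r ≤ 1 + r * x * Real.exp (r * x) := by
  have h₁ : (1 + x) ^ r ≤ Real.exp (r * x) := by
    rw [mul_comm, Real.exp_mul]
    exact Real.rpow_le_rpow (by positivity) (by linarith [Real.add_one_le_exp x]) hr
  have h₂ : Real.exp (-(r * x)) * Real.exp (r * x) = 1 := by
    rw [← Real.exp_add]; simp
  nlinarith [Real.add_one_le_exp (-(r * x)), Real.exp_pos (r * x)]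

/-- Three steps of the power `m ^ (-r)` are controlled by a first-order correction. -/
theorem rpow_neg_le_rpow_neg_add_three {r m : ℝ} (hr : 0 < r) (hm : 1 ≤ m) :
    m ^ (-r) ≤ (m + 3) ^ (-r) * (1 + 12 * r * Real.exp (3 * r) / (m + 3)) := by
  have hm0 : 0 < m := by linarith
  have hx : 3 / m ≤ 3 := div_le_self (by norm_num) hm
  have hx' : 3 / m ≤ 12 / (m + 3) := by
    rw [div_le_div_iff₀ hm0 (by linarith)]; linarith
  have h₁ : (1 + 3 / m) ^ r ≤ 1 + 12 * r * Real.exp (3 * r) / (m + 3) := by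
    calc (1 + 3 / m) ^ r ≤ 1 + r * (3 / m) * Real.exp (r * (3 / m)) :=
          one_add_rpow_le_one_add_mul_exp (by positivity) hr.le
      _ ≤ 1 + r * (12 / (m + 3)) * Real.exp (r * 3) := by gcongr
      _ = 1 + 12 * r * Real.exp (3 * r) / (m + 3) := by rw [mul_comm r 3]; ring
  have h₂ : m ^ (-r) = (m + 3) ^ (-r) * (1 + 3 / m) ^ r := by
    have : 1 + 3 / m = (m + 3) / m := by field_simp
    rw [this, Real.div_rpow (by linarith) hm0.le, Real.rpow_neg hm0.le,
      Real.rpow_neg (by linarith)]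
    have := Real.rpow_pos_of_pos hm0 r
    have := Real.rpow_pos_of_pos (show 0 < m + 3 by linarith) r
    field_simp
  rw [h₂]
  gcongr

/-- A three-step recursion `S (m + 3) ^ (1 + 1 / r) ≤ C₂ (S m - S (m + 3))` forces
the polynomial decay `S n = O(n ^ (-r))`. -/
theorem exists_le_mul_rpow_neg_of_recursion {r C₂ : ℝ} (hr : 0 < r) (hC₂ : 0 < C₂)
    {S : ℕ → ℝ} (hS : ∀ n, 0 ≤ S n) (hSmono : Antitone S) (M : ℕ)
    (hrec : ∀ m, M ≤ m → S (m + 3) ^ (1 + r⁻¹) ≤ C₂ * (S m - S (m + 3))) :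
    ∃ C > (0 : ℝ), ∀ n : ℕ, 1 ≤ n → S n ≤ C * (n : ℝ) ^ (-r) := by
  set K : ℝ := 12 * r * Real.exp (3 * r) with hK
  have hKpos : 0 < K := by positivity
  set C : ℝ := S 0 * ((M : ℝ) + 3) ^ r + (K * C₂) ^ r with hC
  have hCpos : 0 < C := by
    have := hS 0
    positivity
  have hCK : K * C₂ ≤ C ^ r⁻¹ := by
    calc K * C₂ = ((K * C₂) ^ r) ^ r⁻¹ := (Real.rpow_rpow_inv (by positivity) hr.ne').symm
      _ ≤ C ^ r⁻¹ := by
        have := mul_nonneg (hS 0) (show 0 ≤ ((M : ℝ) + 3) ^ r by positivity)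
        exact Real.rpow_le_rpow (by positivity) (by linarith) (by positivity)
  refine ⟨C, hCpos, fun n => ?_⟩
  induction n using Nat.strong_induction_on with
  | _ n ih =>
  intro hn
  have hn0 : (0 : ℝ) < n := by exact_mod_cast hn
  rcases le_or_gt n (M + 3) with h | h
  · have hnM : (n : ℝ) ≤ (M : ℝ) + 3 := by exact_mod_cast h
    rw [Real.rpow_neg hn0.le, ← div_eq_mul_inv, le_div_iff₀ (by positivity)]
    calc S n * (n : ℝ) ^ r ≤ S 0 * ((M : ℝ) + 3) ^ r := by
          have := hS 0
          have := hSmono (Nat.zero_le n)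
          gcongr
      _ ≤ C := by
          have : 0 ≤ (K * C₂) ^ r := by positivity
          linarith
  · obtain ⟨m, rfl⟩ : ∃ m, n = m + 3 := ⟨n - 3, by omega⟩
    have hm1 : 1 ≤ m := by omega
    by_contra! hlt
    have hm := ih m (by omega) hm1
    have hdec := rpow_neg_le_rpow_neg_add_three hr (show (1 : ℝ) ≤ m by exact_mod_cast hm1)
    have hr' := hrec m (by omega)
    push_cast at hlt hn0
    set a : ℝ := ((m : ℝ) + 3) ^ (-r) with ha
    have ha0 : 0 < a := by positivity
    have hpow : (C * a) ^ (1 + r⁻¹) = C * a * (C ^ r⁻¹ / (m + 3)) := by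
      rw [Real.rpow_add (by positivity), Real.rpow_one, Real.mul_rpow hCpos.le ha0.le, ha,
        ← Real.rpow_mul hn0.le, neg_mul, mul_inv_cancel₀ hr.ne', Real.rpow_neg_one,
        div_eq_mul_inv]
    have hlow : C * a * (K * C₂ / (m + 3)) ≤ C₂ * (S m - S (m + 3)) := by
      calc C * a * (K * C₂ / (m + 3)) ≤ C * a * (C ^ r⁻¹ / (m + 3)) := by gcongr
        _ = (C * a) ^ (1 + r⁻¹) := hpow.symm
        _ ≤ S (m + 3) ^ (1 + r⁻¹) :=
            Real.rpow_le_rpow (by positivity) hlt.le (by positivity)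
        _ ≤ _ := hr'
    have hdiff : C * a * (K / (m + 3)) ≤ S m - S (m + 3) := by
      refine le_of_mul_le_mul_left (le_of_eq_of_le ?_ hlow) hC₂
      ring
    have hstep := mul_le_mul_of_nonneg_left hdec hCpos.le
    have hexp : C * (a * (1 + K / (m + 3))) = C * a + C * a * (K / (m + 3)) := by ring
    linarith

/-- the `θ ∈ (1/2, 1)` case of the local convergence rate:
the tail-length recursion forces the sublinear rate `S_n ≤ C n^{−(1−θ)/(2θ−1)}`. -/
theorem stmt13 (θ C₂ : ℝ) (hθ : θ ∈ Set.Ioo (1 / 2 : ℝ) 1) (hC₂ : 0 < C₂)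
    (S : ℕ → ℝ) (hS : ∀ n, 0 ≤ S n) (hSmono : Antitone S)
    (N : ℕ) (hN : 2 ≤ N)
    (hrec : ∀ n, N ≤ n →
      (S (n + 1)) ^ (θ / (1 - θ)) ≤ C₂ * (S (n - 2) - S (n + 1))) :
    ∃ C > (0 : ℝ), ∀ n : ℕ, 1 ≤ n → S n ≤ C * (n : ℝ) ^ (-(1 - θ) / (2 * θ - 1)) := by
  obtain ⟨hθ₁, hθ₂⟩ := hθ
  have h₁ : 0 < 1 - θ := by linarith
  have h₂ : 0 < 2 * θ - 1 := by linarith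
  have hexp : θ / (1 - θ) = 1 + ((1 - θ) / (2 * θ - 1))⁻¹ := by
    rw [inv_div]
    field_simp
    ring
  rw [neg_div]
  refine exists_le_mul_rpow_neg_of_recursion (div_pos h₁ h₂) hC₂ hS hSmono N fun m hm => ?_
  rw [← hexp]
  exact hrec (m + 2) (by omega)
end
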